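/- In the abelian group G = ℤ/5 × ℤ/5 × ℤ/9 (of order 225), the four 8-element subsets B₁ = {(0,0,0),(0,0,1),(0,1,2),(0,4,2),(1,0,3),(1,1,7),(4,0,3),(4,4,7)}, B₂ = {(0,0,0),(0,0,2),(1,4,5),(2,2,4),(2,4,6),(3,1,6),(3,3,4),(4,1,5)}, B₃ = {(0,0,0),(0,0,3),(1,2,1),(1,3,7),(2,0,4),(3,0,4),(4,2,7),(4,3,1)}, B₄ = {(0,0,0),(0,0,4),(0,2,1),(0,3,1),(2,1,3),(2,3,8),(3,2,8),(3,4,3)} form a (225,8,1)-difference family: every nonzero element g of G has exactly one representation g = x − y with x, y belonging to the same block Bᵢ. -/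

import Mathlib

def B6 : Fin 4 → Finset (ZMod 5 × ZMod 5 × ZMod 9) :=
  ![({(0, 0, 0), (0, 0, 1), (0, 1, 2), (0, 4, 2), (1, 0, 3), (1, 1, 7), (4, 0, 3), (4, 4, 7)} : Finset (ZMod 5 × ZMod 5 × ZMod 9)),
    ({(0, 0, 0), (0, 0, 2), (1, 4, 5), (2, 2, 4), (2, 4, 6), (3, 1, 6), (3, 3, 4), (4, 1, 5)} : Finset (ZMod 5 × ZMod 5 × ZMod 9)),
    ({(0, 0, 0), (0, 0, 3), (1, 2, 1), (1, 3, 7), (2, 0, 4), (3, 0, 4), (4, 2, 7), (4, 3, 1)} : Finset (ZMod 5 × ZMod 5 × ZMod 9)),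
    ({(0, 0, 0), (0, 0, 4), (0, 2, 1), (0, 3, 1), (2, 1, 3), (2, 3, 8), (3, 2, 8), (3, 4, 3)} : Finset (ZMod 5 × ZMod 5 × ZMod 9))]

theorem card_B6 : ∀ i : Fin 4, (B6 i).card = 8 := by decide +kernel

/-- The mixed-radix code of an element, a natural number below `225`. -/
def code (g : ZMod 5 × ZMod 5 × ZMod 9) : ℕ :=
  45 * g.1.val + 9 * g.2.1.val + g.2.2.val

theorem code_lt (g : ZMod 5 × ZMod 5 × ZMod 9) : code g < 225 := by
  have h₁ := g.1.val_lt
  have h₂ := g.2.1.val_lt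
  have h₃ := g.2.2.val_lt
  unfold code
  omega

theorem code_injective : Function.Injective code := by
  intro g h hgh
  have h₁ := g.2.1.val_lt
  have h₂ := g.2.2.val_lt
  have h₃ := h.2.1.val_lt
  have h₄ := h.2.2.val_lt
  unfold code at hgh
  refine Prod.ext (ZMod.val_injective 5 ?_)
    (Prod.ext (ZMod.val_injective 5 ?_) (ZMod.val_injective 9 ?_)) <;> omega

theorem exists_eq_of_testBit_fold {α : Type*} (s : Finset α) (f : α → ℕ) (n : ℕ)
    (h : (s.fold (· ||| · : ℕ → ℕ → ℕ) 0 fun a => 2 ^ f a).testBit n = true) : ∃ a ∈ s, f a = n := by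
  induction s using Finset.cons_induction with
  | empty => simp at h
  | cons a s ha ih =>
    rw [Finset.fold_cons, Nat.testBit_or, Bool.or_eq_true, Nat.testBit_two_pow,
      decide_eq_true_eq] at h
    rcases h with h | h
    · exact ⟨a, Finset.mem_cons_self a s, h⟩
    · obtain ⟨b, hb, rfl⟩ := ih h
      exact ⟨b, Finset.mem_cons_of_mem hb, rfl⟩

theorem fold_code_sub :
    ((Finset.univ.sigma fun i => B6 i ×ˢ B6 i).fold (· ||| · : ℕ → ℕ → ℕ) 0
      fun t => 2 ^ code (t.2.1 - t.2.2)) = 2 ^ 225 - 1 := by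
  decide +kernel

theorem exists_sub_eq (g : ZMod 5 × ZMod 5 × ZMod 9) :
    ∃ i : Fin 4, ∃ x ∈ B6 i, ∃ y ∈ B6 i, x - y = g := by
  have h : (2 ^ 225 - 1).testBit (code g) = true := by
    rw [Nat.testBit_two_pow_sub_one, decide_eq_true_eq]
    exact code_lt g
  rw [← fold_code_sub] at h
  obtain ⟨⟨i, x, y⟩, hxy, h⟩ := exists_eq_of_testBit_fold _ _ _ h
  simp only [Finset.mem_sigma, Finset.mem_univ, true_and, Finset.mem_product] at hxy
  exact ⟨i, x, hxy.1, y, hxy.2, code_injective h⟩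

/-- The ordered pairs of distinct elements lying in a common block. -/
def blockPairs : Finset (Σ _ : Fin 4,
    (ZMod 5 × ZMod 5 × ZMod 9) × (ZMod 5 × ZMod 5 × ZMod 9)) :=
  Finset.univ.sigma fun i => (B6 i).offDiag

theorem card_blockPairs : blockPairs.card = 224 := by
  simp [blockPairs, Finset.offDiag_card, card_B6]

theorem image_sub_blockPairs :
    blockPairs.image (fun t => t.2.1 - t.2.2) = Finset.univ.erase 0 := by
  ext g
  simp only [blockPairs, Finset.mem_image, Finset.mem_sigma, Finset.mem_univ, true_and,
    Finset.mem_offDiag, Finset.mem_erase, and_true]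
  constructor
  · rintro ⟨t, ⟨-, -, hne⟩, rfl⟩
    exact sub_ne_zero.mpr hne
  · intro hg
    obtain ⟨i, x, hx, y, hy, rfl⟩ := exists_sub_eq g
    exact ⟨⟨i, x, y⟩, ⟨hx, hy, sub_ne_zero.mp hg⟩, rfl⟩

theorem injOn_sub_blockPairs :
    Set.InjOn (fun t => t.2.1 - t.2.2) (blockPairs : Set (Σ _ : Fin 4,
      (ZMod 5 × ZMod 5 × ZMod 9) × (ZMod 5 × ZMod 5 × ZMod 9))) := by
  rw [← Finset.card_image_iff, image_sub_blockPairs, card_blockPairs,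
    Finset.card_erase_of_mem (Finset.mem_univ _)]
  simp [ZMod.card]

theorem stmt_6 :
    (∀ i : Fin 4, (B6 i).card = 8) ∧
    ∀ g : ZMod 5 × ZMod 5 × ZMod 9, g ≠ 0 →
      ∃! t : Fin 4 × (ZMod 5 × ZMod 5 × ZMod 9) × (ZMod 5 × ZMod 5 × ZMod 9),
        t.2.1 ∈ B6 t.1 ∧ t.2.2 ∈ B6 t.1 ∧ t.2.1 - t.2.2 = g := by
  refine ⟨card_B6, fun g hg => ?_⟩
  obtain ⟨i, x, hx, y, hy, rfl⟩ := exists_sub_eq g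
  refine ⟨(i, x, y), ⟨hx, hy, rfl⟩, ?_⟩
  rintro ⟨j, z, w⟩ ⟨hz, hw, hzw⟩
  dsimp only at hz hw hzw
  have hne : z ≠ w := sub_ne_zero.mp (hzw ▸ hg)
  have h := @injOn_sub_blockPairs ⟨j, z, w⟩ (by simp [blockPairs, hz, hw, hne])
    ⟨i, x, y⟩ (by simp [blockPairs, hx, hy, sub_ne_zero.mp hg]) hzw
  cases h
  rfl
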